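/- Let A be a unital C*-algebra, n ≥ 3 and k ≥ 1 integers, and p a family as in the context (a representation of Mor⁺(K_nᵏ, K_n)). Let S ⊆ Fin k and let (𝐱, 𝐲) and (𝐱̃, 𝐲̃) be two pairs of tuples in Fin k → Fin n such that 𝐱(i) = 𝐲(i) if and only if i ∈ S, and 𝐱̃(i) = 𝐲̃(i) if and only if i ∈ S. Then Σ_{a ∈ Fin n} p(𝐱, a) · p(𝐲, a) = Σ_{a ∈ Fin n} p(𝐱̃, a) · p(𝐲̃, a); i.e., the element Π_S does not depend on the choice of pair with agreement set exactly S. -/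

import Mathlib

theorem clique_sum {A : Type*} [CStarAlgebra A] (n : ℕ) (q : Fin n → Fin n → A)
    (hidem : ∀ j a, q j a * q j a = q j a)
    (hsa : ∀ j a, star (q j a) = q j a)
    (hsum : ∀ j, ∑ a, q j a = 1)
    (horth : ∀ j l a, j ≠ l → q j a * q l a = 0) (a : Fin n) :
    ∑ j, q j a = 1 := by
  letI : PartialOrder A := CStarAlgebra.spectralOrder A
  haveI : StarOrderedRing A := CStarAlgebra.spectralOrderedRing A
  have hid : ∀ a, (∑ j, q j a) * (∑ j, q j a) = ∑ j, q j a := by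
    intro a
    rw [Finset.sum_mul]
    refine Finset.sum_congr rfl fun j _ => ?_
    rw [Finset.mul_sum, Finset.sum_eq_single j]
    · exact hidem j a
    · intro l _ hl
      exact horth j l a (Ne.symm hl)
    · simp
  have hst : ∀ a, star (∑ j, q j a) = ∑ j, q j a := by
    intro a
    rw [star_sum]
    exact Finset.sum_congr rfl fun j _ => hsa j a
  have hnn : ∀ a ∈ (Finset.univ : Finset (Fin n)), 0 ≤ 1 - ∑ j, q j a := by
    intro a _
    have h : 1 - ∑ j, q j a = star (1 - ∑ j, q j a) * (1 - ∑ j, q j a) := by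
      rw [star_sub, star_one, hst, sub_mul, mul_sub, mul_sub, hid]
      simp
    rw [h]
    exact star_mul_self_nonneg _
  have hz : ∑ a, (1 - ∑ j, q j a) = 0 := by
    rw [Finset.sum_sub_distrib, Finset.sum_comm]
    simp [hsum]
  have := (Finset.sum_eq_zero_iff_of_nonneg hnn).1 hz a (Finset.mem_univ a)
  exact (sub_eq_zero.1 this).symm

theorem exists_perm {α : Type*} [DecidableEq α] (s t y w : α) (hst : s ≠ t) (hyw : y ≠ w) :
    ∃ σ : Equiv.Perm α, σ s = y ∧ σ t = w := by
  refine ⟨(Equiv.swap t ((Equiv.swap s y) w)).trans (Equiv.swap s y), ?_, ?_⟩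
  · have h : s ≠ (Equiv.swap s y) w := by
      intro h
      apply hyw
      have := congrArg (Equiv.swap s y) h
      simpa using this
    simp [Equiv.swap_apply_of_ne_of_ne hst h]
  · simp

theorem pair_add {A : Type*} [CStarAlgebra A]
    (n k : ℕ) (hn : 3 ≤ n)
    (p : (Fin k → Fin n) → Fin n → A)
    (hidem : ∀ x a, p x a * p x a = p x a)
    (hsa : ∀ x a, star (p x a) = p x a)
    (hsum : ∀ x, ∑ a, p x a = 1)
    (horth : ∀ x y a, (∀ i, x i ≠ y i) → p x a * p y a = 0)
    (S : Finset (Fin k)) (x y w : Fin k → Fin n)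
    (hxy : ∀ i, x i = y i ↔ i ∈ S) (hxw : ∀ i, x i = w i ↔ i ∈ Sᶜ) :
    ∑ a, p x a * p y a + ∑ a, p x a * p w a = 1 := by
  have hor : ∀ i, x i = y i ∨ x i = w i := by
    intro i
    by_cases h : i ∈ S
    · exact Or.inl ((hxy i).2 h)
    · exact Or.inr ((hxw i).2 (by simpa using h))
  have hyw : ∀ i, y i ≠ w i := by
    intro i h
    have h1 := hxy i
    have h2 := hxw i
    rw [h, h2] at h1
    simp at h1
  let s : Fin n := ⟨0, by omega⟩
  let t : Fin n := ⟨1, by omega⟩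
  have hst : s ≠ t := by simp [s, t]
  choose σ hs ht using fun i => exists_perm s t (y i) (w i) hst (hyw i)
  have hzs : (fun i => σ i s) = y := funext hs
  have hzt : (fun i => σ i t) = w := funext ht
  have hc := clique_sum n (fun j a => p (fun i => σ i j) a) (fun _ _ => hidem _ _)
    (fun _ _ => hsa _ _) (fun _ => hsum _)
    (fun j l a hjl => horth _ _ _ fun i h => hjl ((σ i).injective h))
  rw [← Finset.sum_add_distrib, ← hsum x]
  refine Finset.sum_congr rfl fun a _ => ?_
  have h1 : p x a = ∑ j, p x a * p (fun i => σ i j) a := by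
    rw [← Finset.mul_sum, hc a, mul_one]
  rw [Finset.sum_eq_add s t hst] at h1
  · rw [hzs, hzt] at h1
    exact h1.symm
  · rintro j _ ⟨hjs, hjt⟩
    apply horth
    intro i h
    rcases hor i with h' | h'
    · exact hjs ((σ i).injective (by rw [hs, ← h', h]))
    · exact hjt ((σ i).injective (by rw [ht, ← h', h]))
  · simp
  · simp

theorem exists_ne_two (n : ℕ) (hn : 3 ≤ n) (a b : Fin n) : ∃ c : Fin n, a ≠ c ∧ b ≠ c := by
  obtain ⟨c, hc⟩ := Finset.exists_mem_notMem_of_card_lt_card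
    (s := ({a, b} : Finset (Fin n))) (t := Finset.univ)
    (lt_of_le_of_lt Finset.card_le_two (by rw [Finset.card_univ, Fintype.card_fin]; omega))
  refine ⟨c, ?_, ?_⟩ <;> rintro rfl <;> simp at hc

theorem exists_agree (n k : ℕ) (hn : 3 ≤ n) (S : Finset (Fin k)) (x x' : Fin k → Fin n)
    (h : ∀ i ∈ S, x i = x' i) :
    ∃ z : Fin k → Fin n, (∀ i, x i = z i ↔ i ∈ S) ∧ (∀ i, x' i = z i ↔ i ∈ S) := by
  choose c hc hc' using fun i => exists_ne_two n hn (x i) (x' i)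
  refine ⟨fun i => if i ∈ S then x i else c i, fun i => ?_, fun i => ?_⟩
  · by_cases hi : i ∈ S <;> simp [hi, hc]
  · by_cases hi : i ∈ S
    · simp [hi, h i hi]
    · simp [hi, hc']

theorem pair_eq {A : Type*} [CStarAlgebra A]
    (n k : ℕ) (hn : 3 ≤ n)
    (p : (Fin k → Fin n) → Fin n → A)
    (hidem : ∀ x a, p x a * p x a = p x a)
    (hsa : ∀ x a, star (p x a) = p x a)
    (hsum : ∀ x, ∑ a, p x a = 1)
    (horth : ∀ x y a, (∀ i, x i ≠ y i) → p x a * p y a = 0)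
    (S : Finset (Fin k)) (x y x' y' : Fin k → Fin n)
    (hxy : ∀ i, x i = y i ↔ i ∈ S) (hxy' : ∀ i, x' i = y' i ↔ i ∈ S)
    (h : ∀ i ∈ S, x i = x' i) :
    ∑ a, p x a * p y a = ∑ a, p x' a * p y' a := by
  have key : ∀ x y z : Fin k → Fin n, (∀ i, x i = y i ↔ i ∈ S) → (∀ i, x i = z i ↔ i ∈ S) →
      ∑ a, p x a * p y a = ∑ a, p x a * p z a := by
    intro x y z h1 h2
    obtain ⟨w, hw, -⟩ := exists_agree n k hn Sᶜ x x (fun _ _ => rfl)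
    exact add_right_cancel ((pair_add n k hn p hidem hsa hsum horth S x y w h1 hw).trans
      (pair_add n k hn p hidem hsa hsum horth S x z w h2 hw).symm)
  have hstar : ∀ x y : Fin k → Fin n, star (∑ a, p x a * p y a) = ∑ a, p y a * p x a := by
    intro x y
    simp [star_sum, hsa]
  obtain ⟨z, hz, hz'⟩ := exists_agree n k hn S x x' h
  rw [key x y z hxy hz, key x' y' z hxy' hz', ← hstar z x, ← hstar z x',
    key z x x' (fun i => eq_comm.trans (hz i)) (fun i => eq_comm.trans (hz' i))]


/-- **Lemma (cool-projections (i)).** Let `A` be a unital C*-algebra, `n ≥ 3`, `k ≥ 1`, and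
`p` a representation of `Mor⁺(K_nᵏ, K_n)`. Let `S ⊆ Fin k` and let `(x, y)` and `(xt, yt)`
be pairs of tuples whose agreement set is exactly `S`. Then
`Σ_a p x a * p y a = Σ_a p xt a * p yt a`; i.e. `Π_S` is well-defined. -/
theorem stmt3 {A : Type*} [CStarAlgebra A]
    (n k : ℕ) (hn : 3 ≤ n) (hk : 1 ≤ k)
    (p : (Fin k → Fin n) → Fin n → A)
    (hidem : ∀ x a, p x a * p x a = p x a)
    (hsa : ∀ x a, star (p x a) = p x a)
    (hsum : ∀ x, ∑ a, p x a = 1)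
    (horth : ∀ x y a, (∀ i, x i ≠ y i) → p x a * p y a = 0)
    (S : Finset (Fin k))
    (x y xt yt : Fin k → Fin n)
    (hxy : ∀ i, x i = y i ↔ i ∈ S)
    (hxtyt : ∀ i, xt i = yt i ↔ i ∈ S) :
    ∑ a, p x a * p y a = ∑ a, p xt a * p yt a := by
  have hx : ∃ u : Fin k → Fin n, (∀ i ∈ Sᶜ, x i = u i) ∧ (∀ i ∈ S, u i = xt i) := by
    refine ⟨fun i => if i ∈ S then xt i else x i, fun i hi => ?_, fun i hi => ?_⟩
    · simp [Finset.mem_compl.1 hi]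
    · simp [hi]
  obtain ⟨u, hu, hut⟩ := hx
  obtain ⟨v, hv, -⟩ := exists_agree n k hn S u u (fun _ _ => rfl)
  obtain ⟨w, hw, hw'⟩ := exists_agree n k hn Sᶜ x u hu
  rw [← pair_eq n k hn p hidem hsa hsum horth S u v xt yt hv hxtyt hut]
  have h1 := pair_add n k hn p hidem hsa hsum horth S x y w hxy hw
  have h2 := pair_add n k hn p hidem hsa hsum horth S u v w hv hw'
  rw [pair_eq n k hn p hidem hsa hsum horth Sᶜ x w u w hw hw' hu] at h1
  exact add_right_cancel (h1.trans h2.symm)
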